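/- arXiv:1612.05040 — 2 statements merged into one kernel-verified Lean document; each statement's English description precedes it below -/
import Mathlib

section
/- Let n ≥ 1 and let A = Circulant(a_0,…,a_{n−1}) ∈ ℝ≥0^{n×n} be a nonzero circulant matrix. Let P = {p ∈ {1,…,n−1} : a_p = λ(A)} and m = gcd of n together with all elements of P. Then for all i, j ∈ {1,…,n}: there exists a walk of length ≥ 1 from i to j in crit(A) and a walk of length ≥ 1 from j to i in crit(A) (i.e., i and j lie in the same strongly connected component of crit(A)) if and only if m divides i − j. In particular, crit(A) consists of exactly m strongly connected components, and the node set of the component containing node i is {j ∈ {1,…,n} : j ≡ i (mod m)}. -/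
open scoped NNReal Classical

namespace MaxAlg

variable {n : ℕ}

/-- cyclic successor on `Fin k` -/
def cyc {k : ℕ} (l : Fin k) : Fin k := ⟨(l.val + 1) % k, Nat.mod_lt _ l.pos⟩

/-- max-algebraic matrix product -/
noncomputable def mmul (A B : Matrix (Fin n) (Fin n) ℝ≥0) : Matrix (Fin n) (Fin n) ℝ≥0 :=
  fun i k => Finset.univ.sup fun j => A i j * B j k

/-- max-algebraic identity matrix -/
def mId (n : ℕ) : Matrix (Fin n) (Fin n) ℝ≥0 := fun i j => if i = j then 1 else 0

/-- max-algebraic matrix power -/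
noncomputable def mpow (A : Matrix (Fin n) (Fin n) ℝ≥0) : ℕ → Matrix (Fin n) (Fin n) ℝ≥0
  | 0 => mId n
  | t + 1 => mmul (mpow A t) A

/-- max-algebraic matrix-vector product -/
noncomputable def mvec (A : Matrix (Fin n) (Fin n) ℝ≥0) (x : Fin n → ℝ≥0) : Fin n → ℝ≥0 :=
  fun i => Finset.univ.sup fun j => A i j * x j

/-- geometric mean of the cycle `c` of length `k` -/
noncomputable def cycMean (A : Matrix (Fin n) (Fin n) ℝ≥0) (k : ℕ) (c : Fin k → Fin n) : ℝ≥0 :=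
  (∏ l : Fin k, A (c l) (c (cyc l))) ^ ((1 : ℝ) / (k : ℝ))

/-- maximum cycle geometric mean λ(A) -/
noncomputable def lam (A : Matrix (Fin n) (Fin n) ℝ≥0) : ℝ≥0 :=
  (Finset.Icc 1 n).sup fun k => Finset.univ.sup fun c : Fin k → Fin n => cycMean A k c

/-- attraction cone Attr(A) -/
def Attr (A : Matrix (Fin n) (Fin n) ℝ≥0) : Set (Fin n → ℝ≥0) :=
  {x | ∃ s : ℕ, mvec (mpow A (s + 1)) x = fun i => lam A * mvec (mpow A s) x i}

/-- circulant matrix built from the vector of values `a_0, …, a_{n-1}` -/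
def circ (a : Fin n → ℝ≥0) : Matrix (Fin n) (Fin n) ℝ≥0 := fun i j => a (j - i)

/-- A is a circulant matrix -/
def IsCirculant (A : Matrix (Fin n) (Fin n) ℝ≥0) : Prop := ∃ a : Fin n → ℝ≥0, A = circ a

/-- (i,j) is a critical edge of A -/
def IsCritEdge (A : Matrix (Fin n) (Fin n) ℝ≥0) (i j : Fin n) : Prop :=
  A i j ≠ 0 ∧ ∃ (k : ℕ) (c : Fin k → Fin n), 1 ≤ k ∧
    (∀ l, A (c l) (c (cyc l)) ≠ 0) ∧
    cycMean A k c = lam A ∧ ∃ l, c l = i ∧ c (cyc l) = j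

/-- there is a walk of length ≥ 1 from i to j in crit(A) -/
def CritWalk (A : Matrix (Fin n) (Fin n) ℝ≥0) (i j : Fin n) : Prop :=
  ∃ l : ℕ, 1 ≤ l ∧ ∃ w : ℕ → Fin n, w 0 = i ∧ w l = j ∧
    ∀ r < l, IsCritEdge A (w r) (w (r + 1))

/-- node i lies on a critical cycle of A -/
def OnCritCycle (A : Matrix (Fin n) (Fin n) ℝ≥0) (i : Fin n) : Prop :=
  ∃ (k : ℕ) (c : Fin k → Fin n), 1 ≤ k ∧
    (∀ l, A (c l) (c (cyc l)) ≠ 0) ∧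
    cycMean A k c = lam A ∧ ∃ l, c l = i

/-- family of one-dimensional intervals with bounds `lo`, `hi`,
each of one of the four forms -/
def IsIntervalFam (S : Fin n → Set ℝ≥0) (lo hi : Fin n → ℝ≥0) : Prop :=
  ∀ i, (S i).Nonempty ∧
    (S i = Set.Icc (lo i) (hi i) ∨ S i = Set.Ico (lo i) (hi i) ∨
     S i = Set.Ioc (lo i) (hi i) ∨ S i = Set.Ioo (lo i) (hi i))

/-- the interval 𝐗 ⊆ ℝ≥0ⁿ determined by the family S -/
def box (S : Fin n → Set ℝ≥0) : Set (Fin n → ℝ≥0) := {x | ∀ i, x i ∈ S i}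

/-- vertex x^{(k)}: x̄ in coordinate k and x̲ elsewhere -/
def vtx (lo hi : Fin n → ℝ≥0) (k : Fin n) : Fin n → ℝ≥0 :=
  Function.update lo k (hi k)

/-- the interval circulant matrix C(𝐚) determined by the interval family Sa -/
def Cset (Sa : Fin n → Set ℝ≥0) : Set (Matrix (Fin n) (Fin n) ℝ≥0) :=
  {A | ∃ a : Fin n → ℝ≥0, (∀ k, a k ∈ Sa k) ∧ A = circ a}

/-- the matrix Â, with â_k = min(a̲, ā_k) where a̲ = max_k a̲_k -/
noncomputable def Ahat (alo ahi : Fin n → ℝ≥0) : Matrix (Fin n) (Fin n) ℝ≥0 :=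
  circ fun k => min (Finset.univ.sup alo) (ahi k)

/-- the matrix A^{(k)} = Circulant(a̲_0,…,a̲_{k−1}, ā_k, a̲_{k+1},…,a̲_{n−1}) -/
def Ak (alo ahi : Fin n → ℝ≥0) (k : Fin n) : Matrix (Fin n) (Fin n) ℝ≥0 :=
  circ (Function.update alo k (ahi k))

end MaxAlg

namespace MaxAlg

lemma cycMean_le {n : ℕ} (a : Fin n → ℝ≥0) {M : ℝ≥0} (hM : ∀ p, a p ≤ M) {k : ℕ}
    (hk : 1 ≤ k) (c : Fin k → Fin n) : cycMean (circ a) k c ≤ M := by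
  have hprod : ∏ l : Fin k, circ a (c l) (c (cyc l)) ≤ M ^ k := by
    calc ∏ l : Fin k, circ a (c l) (c (cyc l)) ≤ ∏ _l : Fin k, M :=
          Finset.prod_le_prod' fun l _ => hM _
      _ = M ^ k := by simp
  calc cycMean (circ a) k c ≤ (M ^ k) ^ ((1 : ℝ) / (k : ℝ)) :=
        NNReal.rpow_le_rpow hprod (by positivity)
    _ = M := by rw [one_div, NNReal.pow_rpow_inv_natCast M (by omega)]

/-- A cycle attaining the bound `M` on all entries uses only entries equal to `M`. -/
lemma eq_of_cycMean_eq {n : ℕ} (a : Fin n → ℝ≥0) {M : ℝ≥0} (hM : ∀ p, a p ≤ M) {k : ℕ}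
    (hk : 1 ≤ k) (c : Fin k → Fin n) (hpos : ∀ l, circ a (c l) (c (cyc l)) ≠ 0)
    (hc : cycMean (circ a) k c = M) (l : Fin k) : circ a (c l) (c (cyc l)) = M := by
  by_contra hne
  have hlt : ∏ l : Fin k, circ a (c l) (c (cyc l)) < ∏ _l : Fin k, M :=
    Finset.prod_lt_prod (fun l _ => pos_iff_ne_zero.mpr (hpos l)) (fun l _ => hM _)
      ⟨l, Finset.mem_univ _, lt_of_le_of_ne (hM _) hne⟩
  have hpow : ∏ l : Fin k, circ a (c l) (c (cyc l)) = M ^ k := by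
    rw [← hc, cycMean, one_div, NNReal.rpow_inv_natCast_pow _ (by omega)]
  simp [hpow] at hlt

/-- The cycle of length `n + 1` starting at `i` with constant step `p`. -/
def stepCycle {n : ℕ} (i p : Fin (n + 1)) (l : Fin (n + 1)) : Fin (n + 1) := i + (l : ℕ) • p

lemma card_nsmul_fin {n : ℕ} (p : Fin (n + 1)) : (n + 1) • p = 0 := by
  simpa using card_nsmul_eq_zero' (x := p)

lemma stepCycle_cyc {n : ℕ} (i p l : Fin (n + 1)) :
    stepCycle i p (cyc l) = stepCycle i p l + p := by
  have hmod : ((l.val + 1) % (n + 1)) • p = (l.val + 1) • p := by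
    conv_rhs => rw [← Nat.mod_add_div (l.val + 1) (n + 1), add_nsmul, mul_nsmul,
      card_nsmul_fin, nsmul_zero, add_zero]
  simp only [stepCycle, cyc, hmod, succ_nsmul, add_assoc]

lemma circ_stepCycle {n : ℕ} (a : Fin (n + 1) → ℝ≥0) (i p l : Fin (n + 1)) :
    circ a (stepCycle i p l) (stepCycle i p (cyc l)) = a p := by
  simp [circ, stepCycle_cyc]

lemma cycMean_stepCycle {n : ℕ} (a : Fin (n + 1) → ℝ≥0) (i p : Fin (n + 1)) :
    cycMean (circ a) (n + 1) (stepCycle i p) = a p := by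
  simp only [cycMean, circ_stepCycle, Finset.prod_const, Finset.card_univ, Fintype.card_fin]
  rw [one_div, NNReal.pow_rpow_inv_natCast _ (by omega)]

lemma le_lam_circ {n : ℕ} (a : Fin (n + 1) → ℝ≥0) (p : Fin (n + 1)) : a p ≤ lam (circ a) := by
  rw [← cycMean_stepCycle a 0 p]
  exact (Finset.le_sup (f := fun c => cycMean (circ a) (n + 1) c) (Finset.mem_univ _)).trans
    (Finset.le_sup (f := fun k => Finset.univ.sup fun c : Fin k → Fin (n + 1) =>
      cycMean (circ a) k c) (Finset.mem_Icc.mpr ⟨by omega, le_rfl⟩))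

lemma exists_eq_lam_circ {n : ℕ} (a : Fin (n + 1) → ℝ≥0) : ∃ p, a p = lam (circ a) := by
  obtain ⟨p, hp⟩ := Finite.exists_max a
  refine ⟨p, le_antisymm (le_lam_circ a p) ?_⟩
  exact Finset.sup_le fun k hk => Finset.sup_le fun c _ =>
    cycMean_le a hp (Finset.mem_Icc.mp hk).1 c

lemma lam_circ_ne_zero {n : ℕ} {a : Fin (n + 1) → ℝ≥0} (hA : circ a ≠ 0) :
    lam (circ a) ≠ 0 := by
  intro h
  refine hA (funext fun i => funext fun j => ?_)
  simpa [h, circ] using le_lam_circ a (j - i)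

lemma isCritEdge_circ_iff {n : ℕ} {a : Fin (n + 1) → ℝ≥0} (hA : circ a ≠ 0)
    (i j : Fin (n + 1)) : IsCritEdge (circ a) i j ↔ a (j - i) = lam (circ a) := by
  constructor
  · rintro ⟨-, k, c, hk, hpos, hc, l, rfl, rfl⟩
    exact eq_of_cycMean_eq a (le_lam_circ a) hk c hpos hc l
  · intro h
    have hne : a (j - i) ≠ 0 := h ▸ lam_circ_ne_zero hA
    refine ⟨hne, n + 1, stepCycle i (j - i), by omega, fun l => ?_, ?_, 0, ?_, ?_⟩
    · rwa [circ_stepCycle]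
    · rw [cycMean_stepCycle, h]
    · simp [stepCycle]
    · rw [stepCycle_cyc]
      simp [stepCycle]

lemma critWalk_of_transGen {n : ℕ} {A : Matrix (Fin n) (Fin n) ℝ≥0} {i j : Fin n}
    (h : Relation.TransGen (IsCritEdge A) i j) : CritWalk A i j := by
  induction h with
  | @single b hb =>
    refine ⟨1, le_rfl, fun r => if r = 0 then i else b, by simp, by simp, fun r hr => ?_⟩
    obtain rfl : r = 0 := by omega
    simpa using hb
  | @tail b c _ hbc ih =>
    obtain ⟨l, hl, w, h0, h1, hw⟩ := ih
    refine ⟨l + 1, by omega, fun r => if r ≤ l then w r else c, by simp [h0], by simp, ?_⟩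
    intro r hr
    rcases Nat.lt_succ_iff_lt_or_eq.mp hr with hlt | rfl
    · simpa [hlt.le, Nat.succ_le_of_lt hlt] using hw r hlt
    · simpa [h1] using hbc

/-- From every node, steps with `a p = λ` reach each translate by the subgroup they generate. -/
lemma transGen_add_of_mem_closure {n : ℕ} {a : Fin (n + 1) → ℝ≥0} (hA : circ a ≠ 0)
    {x : Fin (n + 1)} (hx : x ∈ AddSubgroup.closure {p | a p = lam (circ a)}) :
    ∀ i, Relation.TransGen (IsCritEdge (circ a)) i (i + x) := by
  have hstep : ∀ y, (∀ i, Relation.TransGen (IsCritEdge (circ a)) i (i + y)) →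
      ∀ (k : ℕ) i, Relation.TransGen (IsCritEdge (circ a)) i (i + (k + 1) • y) := by
    intro y hy k
    induction k with
    | zero => simpa using hy
    | succ k ih =>
      intro i
      rw [succ_nsmul, ← add_assoc]
      exact (ih i).trans (hy _)
  have hsingle : ∀ p, a p = lam (circ a) →
      ∀ i, Relation.TransGen (IsCritEdge (circ a)) i (i + p) := fun p hp i =>
    .single ((isCritEdge_circ_iff hA _ _).mpr (by simpa using hp))
  have hzero : ∀ i, Relation.TransGen (IsCritEdge (circ a)) i (i + 0) := by
    intro i
    obtain ⟨p, hp⟩ := exists_eq_lam_circ a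
    simpa only [card_nsmul_fin] using hstep p (hsingle p hp) n i
  induction hx using AddSubgroup.closure_induction with
  | mem p hp => exact hsingle p hp
  | zero => exact hzero
  | add x y _ _ hx hy =>
    intro i
    rw [← add_assoc]
    exact (hx i).trans (hy _)
  | neg x _ hx =>
    intro i
    have hneg : -x = n • x := by
      rw [neg_eq_iff_add_eq_zero, ← succ_nsmul', card_nsmul_fin]
    rw [hneg]
    cases n with
    | zero => simpa using hzero i
    | succ n => exact hstep x hx n i

lemma natCast_zsmul_one_fin {n : ℕ} (x : Fin (n + 1)) :
    ((x : ℕ) : ℤ) • (1 : Fin (n + 1)) = x := by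
  rw [natCast_zsmul]
  open scoped Fin.CommRing in
  rw [nsmul_one, Fin.cast_val_eq_self]

/-- A subgroup of `Fin (n + 1)` containing a set contains every difference divisible by the
gcd of `n + 1` and the elements of that set. -/
lemma sub_mem_of_gcd_dvd {n : ℕ} (H : AddSubgroup (Fin (n + 1))) (s : Finset (Fin (n + 1)))
    (hs : ∀ p ∈ s, p ∈ H) (i j : Fin (n + 1))
    (h : ((Nat.gcd (n + 1) (s.gcd fun p => (p : ℕ)) : ℕ) : ℤ) ∣ ((i : ℕ) : ℤ) - ((j : ℕ) : ℤ)) :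
    i - j ∈ H := by
  let K : AddSubgroup ℤ := H.comap (zmultiplesHom _ (1 : Fin (n + 1)))
  have hK : ∀ z : ℤ, z ∈ K ↔ z • (1 : Fin (n + 1)) ∈ H := fun z => Iff.rfl
  obtain ⟨g, hg⟩ := Int.subgroup_cyclic K
  have hmem : ∀ z : ℤ, z ∈ K ↔ g ∣ z := fun z => by
    rw [hg, ← AddSubgroup.zmultiples_eq_closure, Int.mem_zmultiples_iff]
  have hn : g.natAbs ∣ n + 1 := by
    rw [← Int.natCast_dvd_natCast, Int.natAbs_dvd, ← hmem, hK, natCast_zsmul, card_nsmul_fin]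
    exact H.zero_mem
  have hp : g.natAbs ∣ s.gcd fun p => (p : ℕ) := by
    refine Finset.dvd_gcd fun p hp => ?_
    rw [← Int.natCast_dvd_natCast, Int.natAbs_dvd, ← hmem, hK, natCast_zsmul_one_fin]
    exact hs p hp
  have hdvd : g ∣ ((i : ℕ) : ℤ) - ((j : ℕ) : ℤ) :=
    (Int.natAbs_dvd.mp (Int.natCast_dvd_natCast.mpr (Nat.dvd_gcd hn hp))).trans h
  rw [← hmem, hK, sub_zsmul, natCast_zsmul_one_fin, natCast_zsmul_one_fin] at hdvd
  rwa [sub_eq_add_neg]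

lemma dvd_sub_of_dvd_val_sub {n m : ℕ} (hm : m ∣ n + 1) {u v : Fin (n + 1)}
    (h : m ∣ ((v - u : Fin (n + 1)) : ℕ)) : (m : ℤ) ∣ ((v : ℕ) : ℤ) - ((u : ℕ) : ℤ) := by
  have hv : (v : ℕ) = ((v - u : Fin (n + 1)) + (u : ℕ)) % (n + 1) := by
    rw [← Fin.val_add, sub_add_cancel]
  have hmod : (u : ℕ) ≡ (v : ℕ) [MOD m] := by
    have h1 : (v : ℕ) ≡ ((v - u : Fin (n + 1)) : ℕ) + (u : ℕ) [MOD m] := by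
      conv_lhs => rw [hv]
      exact (Nat.mod_modEq _ _).of_dvd hm
    have h2 : ((v - u : Fin (n + 1)) : ℕ) + (u : ℕ) ≡ 0 + (u : ℕ) [MOD m] :=
      ((Nat.modEq_zero_iff_dvd).mpr h).add_right _
    simpa using (h1.trans h2).symm
  exact hmod.dvd

end MaxAlg

open MaxAlg in
/-- nodes `i, j` are in the same strongly connected component of `crit(A)`
for a nonzero circulant `A = Circulant(a)` iff `m = gcd(n, p₁, …, p_s)` divides `i - j`,
where `p₁, …, p_s` are the nonzero indices with `a_p = λ(A)`. -/
theorem crit_scc_iff_gcd_dvd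
    (n : ℕ) (hn : 1 ≤ n) (a : Fin n → ℝ≥0) (hA : circ a ≠ 0) :
    ∀ i j : Fin n,
      (CritWalk (circ a) i j ∧ CritWalk (circ a) j i) ↔
        ((Nat.gcd n ((Finset.univ.filter
              (fun p : Fin n => (p : ℕ) ≠ 0 ∧ a p = lam (circ a))).gcd
            (fun p => (p : ℕ))) : ℤ) ∣ ((i : ℕ) : ℤ) - ((j : ℕ) : ℤ)) := by
  obtain ⟨n, rfl⟩ : ∃ k, n = k + 1 := ⟨n - 1, by omega⟩
  intro i j
  constructor
  · rintro ⟨-, l, -, w, rfl, rfl, hw⟩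
    induction l with
    | zero => simp
    | succ l ih =>
      have hedge := (isCritEdge_circ_iff hA _ _).mp (hw l (Nat.lt_succ_self l))
      have hlast := dvd_sub_of_dvd_val_sub (Nat.gcd_dvd_left (n + 1) ((Finset.univ.filter
        (fun p : Fin (n + 1) => (p : ℕ) ≠ 0 ∧ a p = lam (circ a))).gcd
          (fun p => (p : ℕ)))) (u := w l) (v := w (l + 1)) (by
        by_cases h0 : ((w (l + 1) - w l : Fin (n + 1)) : ℕ) = 0
        · rw [h0]
          exact dvd_zero _
        · exact (Nat.gcd_dvd_right _ _).trans
            (Finset.gcd_dvd (Finset.mem_filter.mpr ⟨Finset.mem_univ _, h0, hedge⟩)))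
      simpa using dvd_add hlast (ih fun r hr => hw r (by omega))
  · intro h
    have key : ∀ u v : Fin (n + 1), u - v ∈ AddSubgroup.closure {p | a p = lam (circ a)} →
        CritWalk (circ a) v u := fun u v huv => by
      simpa using critWalk_of_transGen (transGen_add_of_mem_closure hA huv v)
    have hij := sub_mem_of_gcd_dvd (AddSubgroup.closure {p | a p = lam (circ a)}) _
      (fun p hp => AddSubgroup.subset_closure (Finset.mem_filter.mp hp).2.2) i j h
    exact ⟨key j i (by simpa using neg_mem hij), key i j hij⟩
end

section
/- Let n ≥ 1, let 𝐗 ⊆ ℝ≥0^n be an interval with bound vectors x̲, x̄, and let C(𝐚) be an interval circulant matrix such that Â ∈ C(𝐚). Then there exists A ∈ C(𝐚) such that every x ∈ 𝐗 belongs to Attr(A) (i.e., C(𝐚) is possibly 𝐗-robust) if and only if x^{(i)} ∈ Attr(Â) for every i ∈ {1,…,n}. -/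
open scoped NNReal Classical

namespace MaxAlg

/-- The max-linear operator of the circulant matrix with values `a`. -/
noncomputable def shiftOp {n : ℕ} (a x : Fin n → ℝ≥0) : Fin n → ℝ≥0 :=
  fun i => Finset.univ.sup fun k => a k * x (i + k)

/-- The orbit of `x` under the circulant operator of `a` is eventually constant. -/
def Stabilizes {n : ℕ} (a x : Fin n → ℝ≥0) : Prop :=
  ∃ s : ℕ, (shiftOp a)^[s + 1] x = (shiftOp a)^[s] x

theorem mvec_circ {n : ℕ} [NeZero n] (a x : Fin n → ℝ≥0) : mvec (circ a) x = shiftOp a x := by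
  funext i
  apply le_antisymm
  · refine Finset.sup_le fun j _ => ?_
    have := Finset.le_sup (f := fun k => a k * x (i + k)) (Finset.mem_univ (j - i))
    simpa [circ, mvec, shiftOp] using this
  · refine Finset.sup_le fun k _ => ?_
    have := Finset.le_sup (f := fun j => circ a i j * x j) (Finset.mem_univ (i + k))
    simpa [circ, mvec, shiftOp] using this

theorem mvec_mmul {n : ℕ} (A B : Matrix (Fin n) (Fin n) ℝ≥0) (x : Fin n → ℝ≥0) :
    mvec (mmul A B) x = mvec A (mvec B x) := by
  funext i
  simp only [mvec, mmul, NNReal.mul_finset_sup, NNReal.finset_sup_mul]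
  rw [Finset.sup_comm]
  simp only [mul_assoc]

theorem mvec_mId {n : ℕ} (x : Fin n → ℝ≥0) : mvec (mId n) x = x := by
  funext i
  apply le_antisymm
  · refine Finset.sup_le fun j _ => ?_
    by_cases h : i = j <;> simp [mId, h]
  · have := Finset.le_sup (f := fun j => mId n i j * x j) (Finset.mem_univ i)
    simpa [mId, mvec] using this

theorem mvec_mpow {n : ℕ} (A : Matrix (Fin n) (Fin n) ℝ≥0) (s : ℕ) (x : Fin n → ℝ≥0) :
    mvec (mpow A s) x = (mvec A)^[s] x := by
  induction s generalizing x with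
  | zero => exact mvec_mId x
  | succ s ih => rw [mpow, mvec_mmul, ih, Function.iterate_succ_apply]

theorem lam_circ {n : ℕ} [NeZero n] (a : Fin n → ℝ≥0) : lam (circ a) = Finset.univ.sup a := by
  apply le_antisymm
  · refine Finset.sup_le fun k hk => Finset.sup_le fun c _ => ?_
    have hk0 : k ≠ 0 := by have := (Finset.mem_Icc.1 hk).1; omega
    have h : ∏ l : Fin k, circ a (c l) (c (cyc l)) ≤ (Finset.univ.sup a) ^ k := by
      calc _ ≤ ∏ _l : Fin k, Finset.univ.sup a :=
            Finset.prod_le_prod' fun l _ => Finset.le_sup (Finset.mem_univ _)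
        _ = _ := by simp
    calc cycMean (circ a) k c ≤ ((Finset.univ.sup a) ^ k) ^ ((1 : ℝ) / (k : ℝ)) :=
          NNReal.rpow_le_rpow h (by positivity)
      _ = _ := by rw [one_div, NNReal.pow_rpow_inv_natCast _ hk0]
  · refine Finset.sup_le fun k _ => ?_
    have hn : n ≠ 0 := NeZero.ne n
    have hper : n • k = 0 := by
      have := card_nsmul_eq_zero (G := Fin n) (x := k)
      simpa using this
    let c : Fin n → Fin n := fun l => l.val • k
    have hc : cycMean (circ a) n c = a k := by
      have h : ∀ l, circ a (c l) (c (cyc l)) = a k := fun l => by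
        have h1 : c (cyc l) = (l.val + 1) • k := by
          change ((l.val + 1) % n) • k = _
          conv_rhs => rw [← Nat.mod_add_div (l.val + 1) n, add_nsmul, mul_comm, mul_nsmul', hper]
          simp
        rw [circ, h1, succ_nsmul]
        simp [c]
      rw [cycMean, Finset.prod_congr rfl fun l _ => h l]
      simp [NNReal.pow_rpow_inv_natCast _ hn]
    rw [← hc]
    refine le_trans ?_ (Finset.le_sup (Finset.mem_Icc.2 ⟨Nat.pos_of_ne_zero hn, le_rfl⟩))
    exact Finset.le_sup (f := fun c : Fin n → Fin n => cycMean (circ a) n c) (Finset.mem_univ c)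

theorem shiftOp_mul_left {n : ℕ} (c : ℝ≥0) (a x : Fin n → ℝ≥0) :
    shiftOp (fun k => c * a k) x = fun i => c * shiftOp a x i := by
  funext i
  simp only [shiftOp, NNReal.mul_finset_sup, mul_assoc]

theorem shiftOp_sup {n : ℕ} {ι : Type*} (s : Finset ι) (a : Fin n → ℝ≥0) (c : ι → ℝ≥0)
    (y : ι → Fin n → ℝ≥0) :
    shiftOp a (fun i => s.sup fun j => c j * y j i) =
      fun i => s.sup fun j => c j * shiftOp a (y j) i := by
  funext i
  simp only [shiftOp, NNReal.mul_finset_sup]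
  rw [Finset.sup_comm]
  simp only [mul_left_comm]

theorem iterate_shiftOp_sup {n : ℕ} {ι : Type*} (s : Finset ι) (a : Fin n → ℝ≥0) (c : ι → ℝ≥0)
    (y : ι → Fin n → ℝ≥0) (t : ℕ) :
    (shiftOp a)^[t] (fun i => s.sup fun j => c j * y j i) =
      fun i => s.sup fun j => c j * (shiftOp a)^[t] (y j) i := by
  induction t generalizing y with
  | zero => rfl
  | succ t ih => rw [Function.iterate_succ_apply, shiftOp_sup, ih]; rfl

theorem shiftOp_mul_right {n : ℕ} (c : ℝ≥0) (a x : Fin n → ℝ≥0) :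
    shiftOp a (fun i => c * x i) = fun i => c * shiftOp a x i := by
  simpa using shiftOp_sup {()} a (fun _ => c) (fun _ => x)

theorem iterate_shiftOp_mul_left {n : ℕ} (c : ℝ≥0) (a x : Fin n → ℝ≥0) (s : ℕ) :
    (shiftOp fun k => c * a k)^[s] x = fun i => c ^ s * (shiftOp a)^[s] x i := by
  induction s with
  | zero => simp
  | succ s ih =>
    rw [Function.iterate_succ_apply', ih, shiftOp_mul_left, shiftOp_mul_right,
      Function.iterate_succ_apply']
    funext i
    ring

theorem mem_Attr_circ_of_sup_eq_zero {n : ℕ} [NeZero n] {a : Fin n → ℝ≥0}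
    (h : Finset.univ.sup a = 0) (x : Fin n → ℝ≥0) : x ∈ Attr (circ a) := by
  refine ⟨0, ?_⟩
  have ha : ∀ k, a k = 0 := fun k =>
    le_antisymm (h ▸ Finset.le_sup (f := a) (Finset.mem_univ k)) zero_le
  rw [mvec_mpow, lam_circ, h]
  funext i
  simp [mvec, circ, ha]

theorem mem_Attr_circ_iff {n : ℕ} [NeZero n] {a : Fin n → ℝ≥0}
    (h : Finset.univ.sup a ≠ 0) (x : Fin n → ℝ≥0) :
    x ∈ Attr (circ a) ↔ Stabilizes (fun k => a k / Finset.univ.sup a) x := by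
  have hmv : mvec (circ a) =
      shiftOp fun k => Finset.univ.sup a * (a k / Finset.univ.sup a) := by
    funext y
    rw [mvec_circ]
    congr
    funext k
    exact (mul_div_cancel₀ _ h).symm
  refine exists_congr fun s => ?_
  rw [mvec_mpow, mvec_mpow, lam_circ, hmv, iterate_shiftOp_mul_left, iterate_shiftOp_mul_left,
    funext_iff, funext_iff]
  refine forall_congr' fun i => ?_
  rw [← mul_assoc, ← pow_succ']
  exact mul_right_inj' (pow_ne_zero _ h)

theorem shiftOp_mono {n : ℕ} {a b x y : Fin n → ℝ≥0} (hab : a ≤ b) (hxy : x ≤ y) :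
    shiftOp a x ≤ shiftOp b y := fun i =>
  Finset.sup_mono_fun fun k _ => mul_le_mul' (hab k) (hxy (i + k))

theorem iterate_shiftOp_mono {n : ℕ} {a b x y : Fin n → ℝ≥0} (hab : a ≤ b) (hxy : x ≤ y)
    (t : ℕ) : (shiftOp a)^[t] x ≤ (shiftOp b)^[t] y := by
  induction t generalizing x y with
  | zero => exact hxy
  | succ t ih => exact ih (shiftOp_mono hab hxy)

theorem le_iterate_shiftOp {n : ℕ} [NeZero n] {a : Fin n → ℝ≥0} {k : Fin n} (hk : a k = 1)
    (x : Fin n → ℝ≥0) : x ≤ (shiftOp a)^[n] x := by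
  have h : ∀ (t : ℕ) (i : Fin n), x (i + t • k) ≤ (shiftOp a)^[t] x i := by
    intro t
    induction t with
    | zero => intro i; simp
    | succ t ih =>
      intro i
      rw [Function.iterate_succ_apply']
      have h1 := Finset.le_sup (f := fun l => a l * (shiftOp a)^[t] x (i + l)) (Finset.mem_univ k)
      simp only [hk, one_mul] at h1
      refine le_trans ?_ h1
      rw [succ_nsmul', ← add_assoc]
      exact ih (i + k)
  intro i
  have hper : n • k = 0 := by
    have := card_nsmul_eq_zero (G := Fin n) (x := k)
    simpa using this
  have := h n i
  rwa [hper, add_zero] at this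

/-- A monotone sequence whose values are zero or monomials in finitely many numbers `≤ 1`
is eventually constant. -/
theorem exists_forall_ge_eq_of_monomial {ι : Type*} [Fintype ι] {a : ι → ℝ≥0}
    (ha : ∀ k, a k ≤ 1) {f : ℕ → ℝ≥0} (hf : Monotone f)
    (hv : ∀ m, f m = 0 ∨ ∃ e : ι → ℕ, f m = ∏ k, a k ^ e k) :
    ∃ N, ∀ m ≥ N, f m = f N := by
  by_contra! hcon
  choose g hg hne using hcon
  have hlt : ∀ N, f N < f (g N) := fun N => lt_of_le_of_ne (hf (hg N)) (hne N).symm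
  let u : ℕ → ℕ := fun m => g^[m + 1] 0
  have hu : StrictMono fun m => f (u m) := strictMono_nat_of_lt_succ fun m => by
    change f (g^[m + 1] 0) < f (g^[m + 1 + 1] 0)
    rw [Function.iterate_succ_apply' g (m + 1)]
    exact hlt _
  have hpos : ∀ m, f (u m) ≠ 0 := fun m => by
    change f (g^[m + 1] 0) ≠ 0
    rw [Function.iterate_succ_apply']
    exact (lt_of_le_of_lt zero_le (hlt _)).ne'
  choose e he using fun m => (hv (u m)).resolve_left (hpos m)
  obtain ⟨i, j, hij, hle⟩ := wellQuasiOrdered_le (α := ι → ℕ) e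
  refine absurd (hu hij) (not_lt.2 ?_)
  simp only [he]
  exact Finset.prod_le_prod' fun k _ => pow_le_pow_of_le_one zero_le (ha k) (hle k)

theorem iterate_shiftOp_monomial {n : ℕ} [NeZero n] (a x : Fin n → ℝ≥0)
    (hx : ∀ i, x i = 0 ∨ ∃ e : Fin n → ℕ, x i = ∏ k, a k ^ e k) (t : ℕ) (i : Fin n) :
    (shiftOp a)^[t] x i = 0 ∨ ∃ e : Fin n → ℕ, (shiftOp a)^[t] x i = ∏ k, a k ^ e k := by
  induction t generalizing x with
  | zero => exact hx i
  | succ t ih =>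
    refine ih (shiftOp a x) fun j => ?_
    obtain ⟨k, -, hk⟩ := Finset.exists_mem_eq_sup Finset.univ Finset.univ_nonempty
      fun k => a k * x (j + k)
    rw [shiftOp, hk]
    rcases hx (j + k) with h | ⟨e, h⟩
    · exact Or.inl (by rw [h, mul_zero])
    · refine Or.inr ⟨e + Pi.single k 1, ?_⟩
      simp only [Pi.add_apply, pow_add, Finset.prod_mul_distrib]
      rw [h, mul_comm, Finset.prod_eq_single k (f := fun l => a l ^ (Pi.single k 1 : Fin n → ℕ) l)]
      · simp
      · intro l _ hl; simp [hl]
      · simp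

theorem eq_sup_single {n : ℕ} (x : Fin n → ℝ≥0) :
    x = fun i => Finset.univ.sup fun j => x j * (Pi.single j 1 : Fin n → ℝ≥0) i := by
  funext i
  apply le_antisymm
  · have := Finset.le_sup (f := fun j => x j * (Pi.single j 1 : Fin n → ℝ≥0) i)
      (Finset.mem_univ i)
    simpa using this
  · refine Finset.sup_le fun j _ => ?_
    by_cases h : i = j
    · subst h; simp
    · simp [h]

/-- The iterates of a normalized circulant operator are ultimately periodic with period `n`. -/
theorem exists_iterate_shiftOp_periodic {n : ℕ} [NeZero n] {a : Fin n → ℝ≥0}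
    (ha : ∀ k, a k ≤ 1) {k : Fin n} (hk : a k = 1) :
    ∃ N, ∀ t ≥ N, ∀ x, (shiftOp a)^[t + n] x = (shiftOp a)^[t] x := by
  have hij : ∀ p : Fin n × Fin n, ∃ N, ∀ m ≥ N,
      (shiftOp a)^[n * m] (Pi.single p.2 1) p.1 = (shiftOp a)^[n * N] (Pi.single p.2 1) p.1 := by
    rintro ⟨i, j⟩
    refine exists_forall_ge_eq_of_monomial
      (f := fun m => (shiftOp a)^[n * m] (Pi.single j 1) i) ha ?_ ?_
    · refine monotone_nat_of_le_succ fun m => ?_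
      rw [Nat.mul_succ, Nat.add_comm, Function.iterate_add_apply]
      exact le_iterate_shiftOp hk _ i
    · intro m
      refine iterate_shiftOp_monomial a _ (fun l => ?_) _ i
      by_cases h : l = j
      · subst h; exact Or.inr ⟨0, by simp⟩
      · exact Or.inl (by simp [h])
  choose N hN using hij
  let M := Finset.univ.sup N
  have hM : ∀ p, N p ≤ M := fun p => Finset.le_sup (Finset.mem_univ p)
  have hbase : ∀ x, (shiftOp a)^[n * (M + 1)] x = (shiftOp a)^[n * M] x := by
    intro x
    rw [eq_sup_single x, iterate_shiftOp_sup, iterate_shiftOp_sup]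
    funext i
    refine Finset.sup_congr rfl fun j _ => ?_
    rw [hN (i, j) (M + 1) ((hM _).trans (Nat.le_succ _)), hN (i, j) M (hM _)]
  refine ⟨n * M, fun t ht x => ?_⟩
  obtain ⟨r, rfl⟩ := Nat.exists_eq_add_of_le ht
  rw [show n * M + r + n = n * (M + 1) + r by ring, Function.iterate_add_apply, hbase,
    ← Function.iterate_add_apply]

theorem iterate_add_mul_of_periodic {α : Type*} {f : α → α} {n N : ℕ}
    (h : ∀ t ≥ N, ∀ x, f^[t + n] x = f^[t] x) {t : ℕ} (ht : N ≤ t) (m : ℕ) (x : α) :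
    f^[t + n * m] x = f^[t] x := by
  induction m with
  | zero => rfl
  | succ m ih => rw [Nat.mul_succ, ← Nat.add_assoc, h _ (by omega), ih]

theorem iterate_eq_of_iterate_succ_eq {α : Type*} {f : α → α} {s : ℕ} {x : α}
    (h : f^[s + 1] x = f^[s] x) {t : ℕ} (ht : s ≤ t) : f^[t] x = f^[s] x := by
  induction t, ht using Nat.le_induction with
  | base => rfl
  | succ t _ ih => rw [Function.iterate_succ_apply', ih, ← Function.iterate_succ_apply' f, h]

theorem Stabilizes.eventually {n : ℕ} {a x : Fin n → ℝ≥0} (h : Stabilizes a x) :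
    ∃ s, ∀ t ≥ s, (shiftOp a)^[t + 1] x = (shiftOp a)^[t] x := by
  obtain ⟨s, hs⟩ := h
  refine ⟨s, fun t ht => ?_⟩
  rw [iterate_eq_of_iterate_succ_eq hs ht, iterate_eq_of_iterate_succ_eq hs (by omega)]

theorem continuous_shiftOp {n : ℕ} [NeZero n] (a : Fin n → ℝ≥0) : Continuous (shiftOp a) := by
  refine continuous_pi fun i => ?_
  exact Continuous.finset_sup_apply fun k _ => by fun_prop

theorem isClosed_setOf_stabilizes {n : ℕ} [NeZero n] {a : Fin n → ℝ≥0}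
    (ha : ∀ k, a k ≤ 1) {k : Fin n} (hk : a k = 1) : IsClosed {x | Stabilizes a x} := by
  obtain ⟨N, hN⟩ := exists_iterate_shiftOp_periodic ha hk
  have heq : {x | Stabilizes a x} = {x | (shiftOp a)^[N + 1] x = (shiftOp a)^[N] x} := by
    ext x
    refine ⟨fun h => ?_, fun h => ⟨N, h⟩⟩
    obtain ⟨s, hs⟩ := h.eventually
    have hn : 1 ≤ n := NeZero.one_le
    have h1 := hs (N + n * s) (by nlinarith)
    rwa [Nat.add_right_comm, iterate_add_mul_of_periodic hN (by omega),
      iterate_add_mul_of_periodic hN le_rfl] at h1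
  rw [heq]
  exact isClosed_eq ((continuous_shiftOp a).iterate _) ((continuous_shiftOp a).iterate _)

/-- Enlarging a circulant matrix without changing its eigenvalue enlarges the attraction cone. -/
theorem Stabilizes.mono {n : ℕ} [NeZero n] {a b x : Fin n → ℝ≥0} (hab : a ≤ b)
    (hb : ∀ k, b k ≤ 1) {k : Fin n} (hk : a k = 1) (h : Stabilizes a x) : Stabilizes b x := by
  have hbk : b k = 1 := le_antisymm (hb k) (hk ▸ hab k)
  obtain ⟨N, hN⟩ := exists_iterate_shiftOp_periodic hb hbk
  obtain ⟨s, hs⟩ := h.eventually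
  have hn : 1 ≤ n := NeZero.one_le
  have hle : ∀ m, x ≤ (shiftOp a)^[n * m] x := by
    intro m
    induction m with
    | zero => exact le_rfl
    | succ m ih =>
      rw [Nat.mul_succ, Nat.add_comm, Function.iterate_add_apply]
      exact ih.trans (le_iterate_shiftOp hk _)
  set y := (shiftOp a)^[n * s] x with hy
  have hay : shiftOp a y = y := by
    rw [hy, ← Function.iterate_succ_apply' (shiftOp a)]
    exact hs _ (by nlinarith)
  have hxy : ∀ t ≥ N, (shiftOp b)^[t] x = (shiftOp b)^[t] y := by
    intro t ht
    refine le_antisymm (iterate_shiftOp_mono le_rfl (hle s) t) ?_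
    calc (shiftOp b)^[t] y ≤ (shiftOp b)^[t] ((shiftOp b)^[n * s] x) :=
          iterate_shiftOp_mono le_rfl (iterate_shiftOp_mono hab le_rfl _) t
      _ = (shiftOp b)^[t] x := by
          rw [← Function.iterate_add_apply, iterate_add_mul_of_periodic hN ht]
  have hmono : Monotone fun t => (shiftOp b)^[t] y := monotone_nat_of_le_succ fun t => by
    rw [Function.iterate_succ_apply]
    refine iterate_shiftOp_mono le_rfl ?_ t
    conv_lhs => rw [← hay]
    exact shiftOp_mono hab le_rfl
  refine ⟨N, ?_⟩
  rw [hxy _ (Nat.le_succ N), hxy _ le_rfl]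
  refine le_antisymm ?_ (hmono (Nat.le_succ N))
  rw [← hN N le_rfl y]
  exact hmono (by omega)

theorem Stabilizes.sup {n : ℕ} {ι : Type*} {s : Finset ι} {a : Fin n → ℝ≥0} (c : ι → ℝ≥0)
    {y : ι → Fin n → ℝ≥0} (h : ∀ j, Stabilizes a (y j)) :
    Stabilizes a (fun i => s.sup fun j => c j * y j i) := by
  choose u hu using fun j => (h j).eventually
  refine ⟨s.sup u, ?_⟩
  rw [iterate_shiftOp_sup, iterate_shiftOp_sup]
  funext i
  exact Finset.sup_congr rfl fun j hj => by rw [hu j _ (Finset.le_sup hj)]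

theorem eq_sup_vtx {n : ℕ} {lo hi x : Fin n → ℝ≥0} (hlo : lo ≤ x) (hhi : x ≤ hi) :
    x = fun i => Finset.univ.sup fun j => x j / hi j * vtx lo hi j i := by
  have hdiag : ∀ i, x i / hi i * hi i = x i := fun i => by
    by_cases h : hi i = 0
    · have : x i = 0 := le_antisymm (h ▸ hhi i) zero_le
      simp [this]
    · exact div_mul_cancel₀ _ h
  funext i
  apply le_antisymm
  · have := Finset.le_sup (f := fun j => x j / hi j * vtx lo hi j i) (Finset.mem_univ i)
    simpa [vtx, hdiag] using this
  · refine Finset.sup_le fun j _ => ?_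
    by_cases h : i = j
    · subst h; simp [vtx, hdiag]
    · simp only [vtx, Function.update_of_ne h]
      exact (mul_le_of_le_one_left zero_le (div_le_one_of_le₀ (hhi j) zero_le)).trans (hlo i)

theorem IsIntervalFam.mem_Icc {n : ℕ} {S : Fin n → Set ℝ≥0} {lo hi : Fin n → ℝ≥0}
    (h : IsIntervalFam S lo hi) {i : Fin n} {v : ℝ≥0} (hv : v ∈ S i) :
    v ∈ Set.Icc (lo i) (hi i) := by
  rcases (h i).2 with e | e | e | e <;> rw [e] at hv
  · exact hv
  · exact Set.Ico_subset_Icc_self hv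
  · exact Set.Ioc_subset_Icc_self hv
  · exact Set.Ioo_subset_Icc_self hv

theorem IsIntervalFam.Icc_subset_closure {n : ℕ} {S : Fin n → Set ℝ≥0} {lo hi : Fin n → ℝ≥0}
    (h : IsIntervalFam S lo hi) (i : Fin n) : Set.Icc (lo i) (hi i) ⊆ closure (S i) := by
  obtain ⟨⟨v, hv⟩, e⟩ := h i
  rcases e with e | e | e | e <;> rw [e] at hv ⊢
  · exact subset_closure
  · rw [closure_Ico (hv.1.trans_lt hv.2).ne]
  · rw [closure_Ioc (hv.1.trans_le hv.2).ne]
  · rw [closure_Ioo (hv.1.trans hv.2).ne]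

theorem IsIntervalFam.vtx_mem_closure_box {n : ℕ} {S : Fin n → Set ℝ≥0} {lo hi : Fin n → ℝ≥0}
    (h : IsIntervalFam S lo hi) (k : Fin n) : vtx lo hi k ∈ closure (box S) := by
  have hbox : box S = Set.pi Set.univ S := by ext x; simp [box]
  have hle : ∀ i, lo i ≤ hi i := fun i => by
    obtain ⟨v, hv⟩ := (h i).1
    exact (h.mem_Icc hv).1.trans (h.mem_Icc hv).2
  rw [hbox, closure_pi_set]
  intro i _
  refine h.Icc_subset_closure i ?_
  by_cases hik : i = k
  · subst hik; simpa [vtx] using hle i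
  · simpa [vtx, hik] using hle i

theorem exists_div_sup_eq_one {n : ℕ} [NeZero n] {a : Fin n → ℝ≥0}
    (h : Finset.univ.sup a ≠ 0) : ∃ k, a k / Finset.univ.sup a = 1 := by
  obtain ⟨k, -, hk⟩ := Finset.exists_mem_eq_sup Finset.univ Finset.univ_nonempty a
  exact ⟨k, by rw [← hk]; exact div_self h⟩

theorem div_sup_le_one {n : ℕ} (a : Fin n → ℝ≥0) (k : Fin n) : a k / Finset.univ.sup a ≤ 1 :=
  div_le_one_of_le₀ (Finset.le_sup (Finset.mem_univ k)) zero_le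

theorem sup_min_sup {n : ℕ} {alo ahi : Fin n → ℝ≥0} (hle : ∀ k, alo k ≤ ahi k) :
    (Finset.univ.sup fun k => min (Finset.univ.sup alo) (ahi k)) = Finset.univ.sup alo :=
  le_antisymm (Finset.sup_le fun _ _ => min_le_left _ _)
    (Finset.sup_mono_fun fun k _ => le_min (Finset.le_sup (Finset.mem_univ k)) (hle k))

end MaxAlg

open MaxAlg in
/-- `C(𝐚)` (containing `Â`) is possibly `𝐗`-robust iff `x⁽ⁱ⁾ ∈ Attr(Â)` for all `i`. -/
theorem possibly_X_robust_iff
    (n : ℕ) (hn : 1 ≤ n)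
    (S : Fin n → Set ℝ≥0) (lo hi : Fin n → ℝ≥0) (hS : IsIntervalFam S lo hi)
    (Sa : Fin n → Set ℝ≥0) (alo ahi : Fin n → ℝ≥0) (hSa : IsIntervalFam Sa alo ahi)
    (hle : ∀ k, alo k ≤ ahi k)
    (hhat : Ahat alo ahi ∈ Cset Sa) :
    (∃ A ∈ Cset Sa, ∀ x ∈ box S, x ∈ Attr A) ↔
      ∀ i : Fin n, vtx lo hi i ∈ Attr (Ahat alo ahi) := by
  have : NeZero n := ⟨by omega⟩
  have hsup := sup_min_sup hle
  rw [Ahat] at hhat ⊢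
  set b : Fin n → ℝ≥0 := fun k => min (Finset.univ.sup alo) (ahi k) with hb
  rcases eq_or_ne (Finset.univ.sup b) 0 with hb0 | hb0
  · exact ⟨fun _ i => mem_Attr_circ_of_sup_eq_zero hb0 _,
      fun _ => ⟨_, hhat, fun x _ => mem_Attr_circ_of_sup_eq_zero hb0 x⟩⟩
  constructor
  · rintro ⟨_, ⟨a, ha, rfl⟩, hrob⟩ i
    have hMa : Finset.univ.sup b ≤ Finset.univ.sup a :=
      hsup.trans_le (Finset.sup_mono_fun fun k _ => (hSa.mem_Icc (ha k)).1)
    have ha0 : Finset.univ.sup a ≠ 0 := ((pos_iff_ne_zero.2 hb0).trans_le hMa).ne'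
    obtain ⟨k, hk⟩ := exists_div_sup_eq_one ha0
    have hsub : box S ⊆ {x | Stabilizes (fun k => a k / Finset.univ.sup a) x} :=
      fun x hx => (mem_Attr_circ_iff ha0 x).1 (hrob x hx)
    have hvtx : Stabilizes (fun k => a k / Finset.univ.sup a) (vtx lo hi i) :=
      closure_minimal hsub (isClosed_setOf_stabilizes (div_sup_le_one a) hk)
        (hS.vtx_mem_closure_box i)
    refine (mem_Attr_circ_iff hb0 _).2 (hvtx.mono (fun l => ?_) (div_sup_le_one b) hk)
    rcases le_total (Finset.univ.sup alo) (ahi l) with h | h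
    · have hl : b l = Finset.univ.sup b := by rw [hsup]; exact min_eq_left h
      change a l / Finset.univ.sup a ≤ b l / Finset.univ.sup b
      rw [hl, div_self hb0]
      exact div_sup_le_one a l
    · have hl : b l = ahi l := min_eq_right h
      change a l / Finset.univ.sup a ≤ b l / Finset.univ.sup b
      rw [hl]
      exact div_le_div₀ zero_le (hSa.mem_Icc (ha l)).2 (pos_iff_ne_zero.2 hb0) hMa
  · intro h
    refine ⟨_, hhat, fun x hx => (mem_Attr_circ_iff hb0 x).2 ?_⟩
    rw [eq_sup_vtx (fun i => (hS.mem_Icc (hx i)).1) (fun i => (hS.mem_Icc (hx i)).2)]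
    exact Stabilizes.sup _ fun i => (mem_Attr_circ_iff hb0 _).1 (h i)
end
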